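/- arXiv:1106.3831 — 6 statements merged into one kernel-verified Lean document; each statement's English description precedes it below -/
import Mathlib

section
/- Let α, β ∈ (0,1) with α + β > 1, let f : ℝ → ℝ be Hölder of exponent α and let g : ℝ → ℝ be Hölder of exponent β. Then for every x ∈ ℝ the Leibniz defect of the h-quantum derivative vanishes in the limit: □_h(f·g)(x) − □_h f(x)·g(x) − f(x)·□_h g(x) → 0 as h → 0⁺. -/
open Filter Topology

/-- The `h`-quantum derivative of a complex-valued function `f` at `x`. -/
noncomputable def boxh (f : ℝ → ℂ) (h x : ℝ) : ℂ :=
  (1 / 2) * (((f (x + h) - f x) / h + (f x - f (x - h)) / h)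
    + Complex.I * ((f (x + h) - f x) / h - (f x - f (x - h)) / h))

/-- The product of the increments of `f` and `g` over a step `σ h`, `|σ| = 1`, is `o(h)`. -/
theorem increments_mul_div_tendsto (α β : ℝ) (hαβ : 1 < α + β) (f g : ℝ → ℝ)
    (hf : ∃ C > 0, ∀ x s : ℝ, |f (x + s) - f x| ≤ C * |s| ^ α)
    (hg : ∃ C > 0, ∀ x s : ℝ, |g (x + s) - g x| ≤ C * |s| ^ β)
    (x σ : ℝ) (hσ : |σ| = 1) :
    Tendsto (fun h : ℝ =>
        (((f (x + σ * h) - f x) * (g (x + σ * h) - g x) / h : ℝ) : ℂ))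
      (nhdsWithin 0 (Set.Ioi 0)) (nhds 0) := by
  obtain ⟨C, hC, hf⟩ := hf
  obtain ⟨K, hK, hg⟩ := hg
  have hlim : Tendsto (fun h : ℝ => C * K * h ^ (α + β - 1))
      (nhdsWithin 0 (Set.Ioi 0)) (nhds 0) := by
    have h1 : ContinuousAt (fun h : ℝ => C * K * h ^ (α + β - 1)) 0 :=
      continuousAt_const.mul (Real.continuousAt_rpow_const _ _ (Or.inr (by linarith)))
    have h2 := h1.tendsto
    rw [Real.zero_rpow (by linarith), mul_zero] at h2
    exact h2.mono_left nhdsWithin_le_nhds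
  refine squeeze_zero_norm' ?_ hlim
  filter_upwards [self_mem_nhdsWithin] with h hh
  have hh : 0 < h := hh
  have e : |σ * h| = h := by rw [abs_mul, hσ, one_mul, abs_of_pos hh]
  have a := hf x (σ * h)
  have b := hg x (σ * h)
  rw [e] at a b
  rw [Complex.norm_real, Real.norm_eq_abs, abs_div, abs_mul, abs_of_pos hh, div_le_iff₀ hh]
  calc _ ≤ (C * h ^ α) * (K * h ^ β) := by gcongr
    _ = C * K * h ^ (α + β - 1) * h := by
      rw [Real.rpow_sub_one hh.ne', Real.rpow_add hh]
      field_simp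

/-- Leibniz defect of the `h`-quantum derivative vanishes as `h → 0⁺` for
Hölder functions `f ∈ H^α`, `g ∈ H^β` with `α + β > 1`. -/
theorem quantum_leibniz_defect_tendsto_zero
    (α β : ℝ) (hα : α ∈ Set.Ioo (0 : ℝ) 1) (hβ : β ∈ Set.Ioo (0 : ℝ) 1)
    (hαβ : 1 < α + β) (f g : ℝ → ℝ)
    (hf : ∃ C > 0, ∀ x s : ℝ, |f (x + s) - f x| ≤ C * |s| ^ α)
    (hg : ∃ C > 0, ∀ x s : ℝ, |g (x + s) - g x| ≤ C * |s| ^ β)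
    (x : ℝ) :
    Tendsto (fun h : ℝ =>
        boxh (fun t => ((f t * g t : ℝ) : ℂ)) h x
          - boxh (fun t => (f t : ℂ)) h x * (g x : ℂ)
          - (f x : ℂ) * boxh (fun t => (g t : ℂ)) h x)
      (nhdsWithin 0 (Set.Ioi 0)) (nhds 0) := by
  have hp := increments_mul_div_tendsto α β hαβ f g hf hg x 1 (by simp)
  have hm := increments_mul_div_tendsto α β hαβ f g hf hg x (-1) (by simp)
  have key := ((hp.sub hm).add ((hp.add hm).const_mul Complex.I)).const_mul (1 / 2 : ℂ)
  simp only [sub_zero, add_zero, mul_zero] at key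
  refine key.congr fun h => ?_
  have e1 : x + 1 * h = x + h := by ring
  have e2 : x + -1 * h = x - h := by ring
  simp only [boxh, e1, e2]
  push_cast
  ring
end

section
/- (Quantum Leibniz rule.) Let α, β ∈ (0,1) with α + β > 1, let f : ℝ → ℝ be Hölder of exponent α and g : ℝ → ℝ be Hölder of exponent β, and let x ∈ ℝ. If f has quantum derivative Df(x) at x and g has quantum derivative Dg(x) at x, then the product f·g has a quantum derivative at x and D(f·g)(x) = Df(x)·g(x) + f(x)·Dg(x). -/
open Filter Topology

theorem quantum_remainder_tendsto
    (α β : ℝ) (hαβ : 1 < α + β) (f g : ℝ → ℝ) (x e : ℝ) (he : |e| = 1)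
    (hf : ∃ C > 0, ∀ x s : ℝ, |f (x + s) - f x| ≤ C * |s| ^ α)
    (hg : ∃ C > 0, ∀ x s : ℝ, |g (x + s) - g x| ≤ C * |s| ^ β) :
    Tendsto (fun h : ℝ =>
      (((f (x + e * h) - f x) * (g (x + e * h) - g x) / h : ℝ) : ℂ))
      (nhdsWithin 0 (Set.Ioi 0)) (nhds 0) := by
  obtain ⟨C, hC, hf⟩ := hf
  obtain ⟨K, hK, hg⟩ := hg
  have hlim : Tendsto (fun h : ℝ => C * K * h ^ (α + β - 1))
      (nhdsWithin 0 (Set.Ioi 0)) (nhds 0) := by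
    have h1 : ContinuousAt (fun h : ℝ => C * K * h ^ (α + β - 1)) 0 :=
      continuousAt_const.mul (Real.continuousAt_rpow_const _ _ (Or.inr (by linarith)))
    have h2 := h1.tendsto
    rw [Real.zero_rpow (by linarith), mul_zero] at h2
    exact h2.mono_left nhdsWithin_le_nhds
  refine squeeze_zero_norm' ?_ hlim
  filter_upwards [self_mem_nhdsWithin] with h hh
  have hh : 0 < h := hh
  have e1 : |e * h| = h := by rw [abs_mul, he, one_mul, abs_of_pos hh]
  have a := hf x (e * h)
  have b := hg x (e * h)
  rw [e1] at a b
  rw [Complex.norm_real, Real.norm_eq_abs, abs_div, abs_mul, abs_of_pos hh, div_le_iff₀ hh]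
  have hp : h ^ α * h ^ β = h ^ (α + β - 1) * h := by
    rw [← Real.rpow_add hh, ← Real.rpow_add_one hh.ne']
    congr 1
    ring
  calc _ ≤ (C * h ^ α) * (K * h ^ β) := by gcongr
    _ = C * K * (h ^ α * h ^ β) := by ring
    _ = _ := by rw [hp]; ring

/-- The quantum Leibniz rule: if `f ∈ H^α`, `g ∈ H^β` with `α + β > 1` and both
have quantum derivatives `Df x`, `Dg x` at `x`, then `f·g` has a quantum
derivative at `x` equal to `Df x · g x + f x · Dg x`. -/
theorem quantum_leibniz_rule
    (α β : ℝ) (hα : α ∈ Set.Ioo (0 : ℝ) 1) (hβ : β ∈ Set.Ioo (0 : ℝ) 1)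
    (hαβ : 1 < α + β) (f g : ℝ → ℝ) (x : ℝ) (Dfx Dgx : ℂ)
    (hf : ∃ C > 0, ∀ x s : ℝ, |f (x + s) - f x| ≤ C * |s| ^ α)
    (hg : ∃ C > 0, ∀ x s : ℝ, |g (x + s) - g x| ≤ C * |s| ^ β)
    (hDf : Tendsto (fun h : ℝ => boxh (fun t => (f t : ℂ)) h x)
      (nhdsWithin 0 (Set.Ioi 0)) (nhds Dfx))
    (hDg : Tendsto (fun h : ℝ => boxh (fun t => (g t : ℂ)) h x)
      (nhdsWithin 0 (Set.Ioi 0)) (nhds Dgx)) :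
    Tendsto (fun h : ℝ => boxh (fun t => ((f t * g t : ℝ) : ℂ)) h x)
      (nhdsWithin 0 (Set.Ioi 0)) (nhds (Dfx * (g x : ℂ) + (f x : ℂ) * Dgx)) := by
  have hP := quantum_remainder_tendsto α β hαβ f g x 1 (by simp) hf hg
  have hM := quantum_remainder_tendsto α β hαβ f g x (-1) (by simp) hf hg
  have key := ((hDf.mul_const (g x : ℂ)).add (hDg.const_mul (f x : ℂ))).add
    (((hP.sub hM).add ((hP.add hM).const_mul Complex.I)).const_mul (1 / 2 : ℂ))
  simp only [sub_zero, add_zero, mul_zero] at key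
  refine key.congr fun h => ?_
  have e1 : x + -1 * h = x - h := by ring
  simp only [boxh, e1, one_mul]
  push_cast
  ring
end

section
/- Let f : ℝ → ℂ be continuous and a < b. Then the integral of the h-quantum derivative over [a,b] converges to the increment of f: ∫_a^b □_h f(x) dx → f(b) − f(a) as h → 0⁺. -/
open Filter Topology

/-- For continuous `f : ℝ → ℂ` and `a < b`, the integral over `[a,b]` of the
`h`-quantum derivative converges to `f(b) − f(a)` as `h → 0⁺`. -/
theorem integral_quantum_deriv_tendsto
    (f : ℝ → ℂ) (hf : Continuous f) (a b : ℝ) (hab : a < b) :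
    Tendsto (fun h : ℝ => ∫ x in a..b, boxh f h x)
      (nhdsWithin 0 (Set.Ioi 0)) (nhds (f b - f a)) := by
  have hii : ∀ u v : ℝ, IntervalIntegrable f MeasureTheory.volume u v :=
    fun u v => hf.intervalIntegrable u v
  set G : ℝ → ℂ := fun t => ∫ x in a..b, f (x + t) with hG
  have hGF : G = fun t => (∫ x in (0:ℝ)..(b + t), f x) - ∫ x in (0:ℝ)..(a + t), f x := by
    funext t
    simp only [hG]
    rw [intervalIntegral.integral_comp_add_right,
      intervalIntegral.integral_interval_sub_left (hii _ _) (hii _ _)]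
  have hF : ∀ c : ℝ, HasDerivAt (fun t => ∫ x in (0:ℝ)..(c + t), f x) (f c) 0 := by
    intro c
    have h1 : HasDerivAt (fun u => ∫ x in (0:ℝ)..u, f x) (f (c + 0)) (c + 0) :=
      intervalIntegral.integral_hasDerivAt_right (hii _ _)
        (hf.stronglyMeasurableAtFilter _ _) hf.continuousAt
    have h2 := h1.comp_const_add c 0
    simpa using h2
  have hD : HasDerivAt G (f b - f a) 0 := by
    rw [hGF]
    exact (hF b).sub (hF a)
  have hS := hasDerivAt_iff_tendsto_slope_zero.1 hD
  have hR : Tendsto (fun h : ℝ => (G h - G 0) / (h : ℂ)) (𝓝[>] 0) (𝓝 (f b - f a)) := by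
    refine (hS.mono_left (nhdsWithin_mono _ (fun x hx => ne_of_gt hx))).congr fun h => ?_
    rw [zero_add, Complex.real_smul, Complex.ofReal_inv]
    ring
  have hneg : Tendsto (fun h : ℝ => -h) (𝓝[>] 0) (𝓝[≠] 0) := by
    refine tendsto_nhdsWithin_iff.2 ⟨?_, ?_⟩
    · have : Tendsto (fun h : ℝ => -h) (𝓝 0) (𝓝 (-0)) := continuous_neg.tendsto 0
      rw [neg_zero] at this
      exact this.mono_left nhdsWithin_le_nhds
    · filter_upwards [self_mem_nhdsWithin] with h hh
      have : (0:ℝ) < h := hh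
      simpa using this.ne'
  have hL : Tendsto (fun h : ℝ => (G 0 - G (-h)) / (h : ℂ)) (𝓝[>] 0) (𝓝 (f b - f a)) := by
    refine (hS.comp hneg).congr fun h => ?_
    simp only [Function.comp]
    rw [zero_add, Complex.real_smul, Complex.ofReal_inv, Complex.ofReal_neg, inv_neg]
    ring
  have key : ∀ h : ℝ, ∫ x in a..b, boxh f h x =
      (1 / 2) * (((G h - G 0) / h + (G 0 - G (-h)) / h)
        + Complex.I * ((G h - G 0) / h - (G 0 - G (-h)) / h)) := by
    intro h
    have i : ∀ t : ℝ, IntervalIntegrable (fun x => f (x + t)) MeasureTheory.volume a b :=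
      fun t => (hf.comp (continuous_id.add continuous_const)).intervalIntegrable a b
    have e : ∀ x, boxh f h x = ((1 + Complex.I) / (2 * h)) * f (x + h)
        + (-(2 * Complex.I) / (2 * h)) * f (x + 0)
        + ((Complex.I - 1) / (2 * h)) * f (x + -h) := by
      intro x
      rw [boxh, add_zero, ← sub_eq_add_neg x h]
      ring
    simp only [e]
    rw [intervalIntegral.integral_add (((i h).const_mul _).add ((i 0).const_mul _))
        ((i (-h)).const_mul _),
      intervalIntegral.integral_add ((i h).const_mul _) ((i 0).const_mul _)]
    simp only [intervalIntegral.integral_const_mul]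
    simp only [hG]
    ring
  simp only [key]
  have hfin := ((hR.add hL).add ((hR.sub hL).const_mul Complex.I)).const_mul (1 / 2 : ℂ)
  convert hfin using 2
  ring
end

section
/- (Quantum Barrow rule.) Let f : ℝ → ℂ be continuous, let a < b, and suppose the quantum derivative Df of f exists uniformly on [a,b]. Then Df is continuous on [a,b] and ∫_a^b Df(x) dx = f(b) − f(a). -/
open Filter Topology

theorem boxh_tendsto_of_hasDerivAt {F : ℝ → ℂ} {c : ℂ} {x : ℝ} (hF : HasDerivAt F c x) :
    Tendsto (fun h => boxh F h x) (𝓝[>] 0) (𝓝 c) := by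
  have h1 := hF.tendsto_slope_zero_right
  have hneg : Tendsto (fun t : ℝ => -t) (𝓝[>] 0) (𝓝[<] 0) := by
    simpa using tendsto_neg_nhdsGT (a := (0 : ℝ))
  have h2 := hF.tendsto_slope_zero_left.comp hneg
  have h3 := (h1.const_mul ((1 + Complex.I) / 2)).add (h2.const_mul ((1 - Complex.I) / 2))
  have e : (1 + Complex.I) / 2 * c + (1 - Complex.I) / 2 * c = c := by ring
  rw [e] at h3
  refine h3.congr fun t => ?_
  simp only [boxh, Function.comp, Complex.real_smul, ← sub_eq_add_neg]
  push_cast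
  rw [inv_neg]
  ring

theorem boxh_hasDerivAt {F f : ℝ → ℂ} (hF : ∀ x, HasDerivAt F (f x) x) (h x : ℝ) :
    HasDerivAt (boxh F h) (boxh f h x) x := by
  have hp := (hF (x + h)).comp_add_const x h
  have hm := (hF (x - h)).comp_sub_const x h
  have h0 := hF x
  have dp := (hp.sub h0).div_const (h : ℂ)
  have dm := (h0.sub hm).div_const (h : ℂ)
  exact ((dp.add dm).add ((dp.sub dm).const_mul Complex.I)).const_mul (1 / 2)

theorem boxh_continuous {f : ℝ → ℂ} (hf : Continuous f) (h : ℝ) : Continuous (boxh f h) := by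
  unfold boxh
  fun_prop

/-- The quantum Barrow rule: if `f : ℝ → ℂ` is continuous, `a < b`, and the
quantum derivative `Df` of `f` exists uniformly on `[a,b]`, then `Df` is
continuous on `[a,b]` and `∫_a^b Df(x) dx = f(b) − f(a)`. -/
theorem quantum_barrow_rule
    (f Df : ℝ → ℂ) (hf : Continuous f) (a b : ℝ) (hab : a < b)
    (hDf : TendstoUniformlyOn (fun h x => boxh f h x) Df
      (nhdsWithin 0 (Set.Ioi 0)) (Set.Icc a b)) :
    ContinuousOn Df (Set.Icc a b) ∧ (∫ x in a..b, Df x) = f b - f a := by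
  have hcont : ∀ h, Continuous (boxh f h) := boxh_continuous hf
  refine ⟨hDf.continuousOn (Frequently.of_forall fun h => (hcont h).continuousOn), ?_⟩
  have hF : ∀ x, HasDerivAt (fun u => ∫ t in (0 : ℝ)..u, f t) (f x) x := fun x =>
    (hf.integral_hasStrictDerivAt 0 x).hasDerivAt
  rw [← Set.uIcc_of_le hab.le] at hDf
  have h1 := TendstoUniformlyOn.tendsto_intervalIntegral_of_continuousOn
    (μ := MeasureTheory.volume) (Eventually.of_forall fun h => (hcont h).continuousOn) hDf
  have h2 := (boxh_tendsto_of_hasDerivAt (hF b)).sub (boxh_tendsto_of_hasDerivAt (hF a))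
  refine tendsto_nhds_unique h1 (h2.congr fun h => ?_)
  exact (intervalIntegral.integral_eq_sub_of_hasDerivAt (fun x _ => boxh_hasDerivAt hF h x)
    ((hcont h).intervalIntegrable _ _)).symm
end

section
/- Let f, g : ℝ² → ℝ be continuous and let a < b, c < d. Then, as h → 0⁺, the double integral ∫_c^d ∫_a^b (□_h g/□x₁(x₁,x₂) − □_h f/□x₂(x₁,x₂)) dx₁ dx₂ converges to the boundary expression ∫_a^b (f(x₁,c) − f(x₁,d)) dx₁ + ∫_c^d (g(b,x₂) − g(a,x₂)) dx₂. -/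
open Filter Topology

/-- The partial `h`-quantum derivative in the first variable of
`f : ℝ × ℝ → ℂ`. -/
noncomputable def boxh1 (f : ℝ × ℝ → ℂ) (h : ℝ) (p : ℝ × ℝ) : ℂ :=
  (1 / 2) * (((f (p.1 + h, p.2) - f p) / h + (f p - f (p.1 - h, p.2)) / h)
    + Complex.I * ((f (p.1 + h, p.2) - f p) / h - (f p - f (p.1 - h, p.2)) / h))

/-- The partial `h`-quantum derivative in the second variable of
`f : ℝ × ℝ → ℂ`. -/
noncomputable def boxh2 (f : ℝ × ℝ → ℂ) (h : ℝ) (p : ℝ × ℝ) : ℂ :=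
  (1 / 2) * (((f (p.1, p.2 + h) - f p) / h + (f p - f (p.1, p.2 - h)) / h)
    + Complex.I * ((f (p.1, p.2 + h) - f p) / h - (f p - f (p.1, p.2 - h)) / h))

noncomputable def dblI (a b c d : ℝ) (A : ℝ × ℝ → ℂ) : ℂ :=
  ∫ x₂ in c..d, ∫ x₁ in a..b, A (x₁, x₂)

lemma inner_cont (a b : ℝ) {A : ℝ × ℝ → ℂ} (hA : Continuous A) :
    Continuous (fun x₂ : ℝ => ∫ x₁ in a..b, A (x₁, x₂)) := by
  apply intervalIntegral.continuous_parametric_intervalIntegral_of_continuous'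
  simp only [Function.uncurry_def]
  fun_prop

lemma dblI_sub (a b c d : ℝ) {A B : ℝ × ℝ → ℂ} (hA : Continuous A) (hB : Continuous B) :
    dblI a b c d (fun p => A p - B p) = dblI a b c d A - dblI a b c d B := by
  unfold dblI
  rw [← intervalIntegral.integral_sub ((inner_cont a b hA).intervalIntegrable _ _)
    ((inner_cont a b hB).intervalIntegrable _ _)]
  congr 1
  ext x
  rw [intervalIntegral.integral_sub]
  · exact Continuous.intervalIntegrable (by fun_prop) _ _
  · exact Continuous.intervalIntegrable (by fun_prop) _ _

lemma dblI_add (a b c d : ℝ) {A B : ℝ × ℝ → ℂ} (hA : Continuous A) (hB : Continuous B) :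
    dblI a b c d (fun p => A p + B p) = dblI a b c d A + dblI a b c d B := by
  unfold dblI
  rw [← intervalIntegral.integral_add ((inner_cont a b hA).intervalIntegrable _ _)
    ((inner_cont a b hB).intervalIntegrable _ _)]
  congr 1
  ext x
  rw [intervalIntegral.integral_add]
  · exact Continuous.intervalIntegrable (by fun_prop) _ _
  · exact Continuous.intervalIntegrable (by fun_prop) _ _

lemma dblI_mul (a b c d : ℝ) (k : ℂ) (A : ℝ × ℝ → ℂ) :
    dblI a b c d (fun p => k * A p) = k * dblI a b c d A := by
  unfold dblI
  simp only [intervalIntegral.integral_const_mul]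

lemma dblI_box (a b c d : ℝ) (h : ℂ) {A B C : ℝ × ℝ → ℂ} (hA : Continuous A)
    (hB : Continuous B) (hC : Continuous C) :
    dblI a b c d (fun p => (1 / 2) * (((A p - B p) / h + (B p - C p) / h)
      + Complex.I * ((A p - B p) / h - (B p - C p) / h)))
    = (1 / 2) * (((dblI a b c d A - dblI a b c d B) / h
        + (dblI a b c d B - dblI a b c d C) / h)
      + Complex.I * ((dblI a b c d A - dblI a b c d B) / h
        - (dblI a b c d B - dblI a b c d C) / h)) := by
  simp only [div_eq_inv_mul _ h]
  rw [dblI_mul, dblI_add, dblI_add, dblI_mul, dblI_mul, dblI_mul, dblI_sub, dblI_sub, dblI_sub,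
    dblI_mul, dblI_mul, dblI_sub, dblI_sub]
  all_goals fun_prop

lemma shift_deriv {P : ℝ → ℂ} (hP : Continuous P) (a b : ℝ) :
    HasDerivAt (fun t : ℝ => ∫ x in a..b, P (x + t)) (P b - P a) 0 := by
  have key : ∀ u : ℝ, HasDerivAt (fun t : ℝ => ∫ x in (0:ℝ)..(u + t), P x) (P u) 0 := by
    intro u
    have h1 : HasDerivAt (fun y : ℝ => ∫ x in (0:ℝ)..y, P x) (P (u + 0)) (u + 0) :=
      intervalIntegral.integral_hasDerivAt_right (hP.intervalIntegrable _ _)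
        (hP.stronglyMeasurableAtFilter _ _) hP.continuousAt
    simpa using h1.comp_const_add u 0
  refine ((key b).sub (key a)).congr_of_eventuallyEq (Eventually.of_forall fun t => ?_)
  simp only [Pi.sub_apply]
  rw [intervalIntegral.integral_comp_add_right (fun x => P x),
    intervalIntegral.integral_interval_sub_left (hP.intervalIntegrable _ _)
      (hP.intervalIntegrable _ _)]

lemma box_lim {Φ : ℝ → ℂ} {L : ℂ} (hΦ : HasDerivAt Φ L 0) :
    Tendsto (fun h : ℝ => (1 / 2 : ℂ) * (((Φ h - Φ 0) / h + (Φ 0 - Φ (-h)) / h)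
      + Complex.I * ((Φ h - Φ 0) / h - (Φ 0 - Φ (-h)) / h))) (𝓝[>] 0) (𝓝 L) := by
  have h1 : Tendsto (fun h : ℝ => (Φ h - Φ 0) / (h : ℂ)) (𝓝[>] 0) (𝓝 L) := by
    have := hΦ.tendsto_slope_zero_right
    refine this.congr fun h => ?_
    simp [div_eq_inv_mul]
  have h2 : Tendsto (fun h : ℝ => (Φ 0 - Φ (-h)) / (h : ℂ)) (𝓝[>] 0) (𝓝 L) := by
    have h0 : HasDerivAt (fun t : ℝ => - Φ (-t)) L 0 := by
      have h3 : HasDerivAt Φ L (-0) := by simpa using hΦ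
      have := (h3.scomp (0:ℝ) (hasDerivAt_neg (0:ℝ))).neg
      have e : -((-1 : ℝ) • L) = L := by simp
      rw [e] at this
      exact this
    refine h0.tendsto_slope_zero_right.congr fun h => ?_
    simp [div_eq_inv_mul]
    ring
  have := ((h1.add h2).add ((h1.sub h2).const_mul Complex.I)).const_mul (1 / 2 : ℂ)
  convert this using 2
  ring

/-- For continuous `f, g : ℝ² → ℝ`, the double integral over
`R = [a,b] × [c,d]` of `□_h g/□x₁ − □_h f/□x₂` converges, as `h → 0⁺`, to the
boundary expression
`∫_a^b (f(x₁,c) − f(x₁,d)) dx₁ + ∫_c^d (g(b,x₂) − g(a,x₂)) dx₂`. -/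
theorem quantum_green_limit
    (f g : ℝ × ℝ → ℝ) (hf : Continuous f) (hg : Continuous g)
    (a b c d : ℝ) (hab : a < b) (hcd : c < d) :
    Tendsto (fun h : ℝ => ∫ x₂ in c..d, ∫ x₁ in a..b,
        (boxh1 (fun p => (g p : ℂ)) h (x₁, x₂)
          - boxh2 (fun p => (f p : ℂ)) h (x₁, x₂)))
      (nhdsWithin 0 (Set.Ioi 0))
      (nhds ((∫ x₁ in a..b, ((f (x₁, c) - f (x₁, d) : ℝ) : ℂ))
        + ∫ x₂ in c..d, ((g (b, x₂) - g (a, x₂) : ℝ) : ℂ))) := by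
  have hF : Continuous (fun p => (f p : ℂ)) := by fun_prop
  have hG : Continuous (fun p => (g p : ℂ)) := by fun_prop
  set F : ℝ × ℝ → ℂ := fun p => (f p : ℂ) with hFd
  set G : ℝ × ℝ → ℂ := fun p => (g p : ℂ) with hGd
  have hP : Continuous (fun x₁ : ℝ => ∫ x₂ in c..d, G (x₁, x₂)) :=
    inner_cont c d (A := fun p => G (p.2, p.1)) (by fun_prop)
  have hQ := inner_cont a b hF
  have d1 : HasDerivAt (fun t : ℝ => dblI a b c d (fun p => G (p.1 + t, p.2)))
      ((∫ x₂ in c..d, G (b, x₂)) - ∫ x₂ in c..d, G (a, x₂)) 0 := by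
    refine (shift_deriv hP a b).congr_of_eventuallyEq (Eventually.of_forall fun t => ?_)
    unfold dblI
    have hc : Continuous (Function.uncurry fun x y : ℝ => G (y + t, x)) := by
      simp only [Function.uncurry_def]
      fun_prop
    refine MeasureTheory.intervalIntegral_intervalIntegral_swap (F := fun x y : ℝ => G (y + t, x)) ?_
    exact (hc.continuousOn.integrableOn_compact
      (isCompact_uIcc.prod isCompact_uIcc)).mono_set
      (Set.prod_mono Set.uIoc_subset_uIcc Set.uIoc_subset_uIcc)
  have d2 : HasDerivAt (fun t : ℝ => dblI a b c d (fun p => F (p.1, p.2 + t)))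
      ((∫ x₁ in a..b, F (x₁, d)) - ∫ x₁ in a..b, F (x₁, c)) 0 := shift_deriv hQ c d
  have key := (box_lim d1).sub (box_lim d2)
  have e1 : (∫ x₁ in a..b, ((f (x₁, c) - f (x₁, d) : ℝ) : ℂ))
      = (∫ x₁ in a..b, F (x₁, c)) - ∫ x₁ in a..b, F (x₁, d) := by
    rw [← intervalIntegral.integral_sub]
    · simp [hFd]
    · exact Continuous.intervalIntegrable (by fun_prop) _ _
    · exact Continuous.intervalIntegrable (by fun_prop) _ _
  have e2 : (∫ x₂ in c..d, ((g (b, x₂) - g (a, x₂) : ℝ) : ℂ))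
      = (∫ x₂ in c..d, G (b, x₂)) - ∫ x₂ in c..d, G (a, x₂) := by
    rw [← intervalIntegral.integral_sub]
    · simp [hGd]
    · exact Continuous.intervalIntegrable (by fun_prop) _ _
    · exact Continuous.intervalIntegrable (by fun_prop) _ _
  rw [e1, e2]
  convert key using 2 with h
  · rw [← dblI_box, ← dblI_box, ← dblI_sub]
    · simp only [dblI, boxh1, boxh2, add_zero, sub_eq_add_neg]
    all_goals fun_prop
  · ring
end

section
/- (Quantum Green theorem.) Let f, g : ℝ² → ℝ be continuous, let a < b, c < d, set R = [a,b] × [c,d], and suppose the partial quantum derivatives D₁g and D₂f exist uniformly on R. Then ∫∫_R (D₁g(x₁,x₂) − D₂f(x₁,x₂)) dx₁ dx₂ = ∫_a^b (f(x₁,c) − f(x₁,d)) dx₁ + ∫_c^d (g(b,x₂) − g(a,x₂)) dx₂, i.e. the double integral equals the counterclockwise line integral of f dx₁ + g dx₂ around the boundary of R. -/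
open Filter Topology

lemma qg_line (φ : ℝ → ℂ) (hφ : Continuous φ) (a b : ℝ) (hab : a ≤ b) (D : ℝ → ℂ)
    (hD : TendstoUniformlyOn (fun (h : ℝ) x => (1 / 2) * (((φ (x + h) - φ x) / h
        + (φ x - φ (x - h)) / h)
      + Complex.I * ((φ (x + h) - φ x) / h - (φ x - φ (x - h)) / h))) D
      (nhdsWithin 0 (Set.Ioi 0)) (Set.Icc a b)) :
    ∫ x in a..b, D x = φ b - φ a := by
  have hint : ∀ a b : ℝ, IntervalIntegrable φ MeasureTheory.volume a b :=
    fun a b => hφ.intervalIntegrable a b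
  have hΦ : ∀ x, HasDerivAt (fun u => ∫ t in (0 : ℝ)..u, φ t) (φ x) x := fun x =>
    intervalIntegral.integral_hasDerivAt_right (hint _ _)
      hφ.stronglyMeasurable.stronglyMeasurableAtFilter hφ.continuousAt
  have hE : Tendsto (fun t : ℝ => ∫ x in a..b, (φ (x + t) - φ x) / t) (𝓝[≠] 0)
      (𝓝 (φ b - φ a)) := by
    refine ((hΦ b).tendsto_slope_zero.sub (hΦ a).tendsto_slope_zero).congr fun t => ?_
    have ht : IntervalIntegrable (fun x => φ (x + t)) MeasureTheory.volume a b :=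
      (hφ.comp (continuous_add_const t)).intervalIntegrable _ _
    rw [intervalIntegral.integral_div, intervalIntegral.integral_sub ht (hint _ _),
      intervalIntegral.integral_comp_add_right φ t]
    have h1 := intervalIntegral.integral_interval_sub_left (hint 0 (b + t)) (hint 0 (a + t))
    have h2 := intervalIntegral.integral_interval_sub_left (hint 0 b) (hint 0 a)
    rw [← h1, ← h2]
    simp only [Complex.real_smul, Complex.ofReal_inv, div_eq_inv_mul]
    ring
  have hE1 := hE.mono_left (nhdsGT_le_nhdsNE 0)
  have hneg : Tendsto (fun t : ℝ => -t) (𝓝[>] 0) (𝓝[≠] 0) := by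
    refine tendsto_nhdsWithin_iff.2 ⟨?_, ?_⟩
    · have : Tendsto (fun t : ℝ => -t) (𝓝 0) (𝓝 (-0)) := continuous_neg.tendsto 0
      rw [neg_zero] at this
      exact this.mono_left nhdsWithin_le_nhds
    · filter_upwards [self_mem_nhdsWithin] with t ht
      simpa using (ne_of_gt ht)
  have hE2 := hE.comp hneg
  have hl : Tendsto (fun h : ℝ => ∫ x in a..b, ((1 / 2 : ℂ) * (((φ (x + h) - φ x) / h
        + (φ x - φ (x - h)) / h)
      + Complex.I * ((φ (x + h) - φ x) / h - (φ x - φ (x - h)) / h)))) (𝓝[>] 0)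
      (𝓝 (φ b - φ a)) := by
    have := ((hE1.add hE2).add ((hE1.sub hE2).const_mul Complex.I)).const_mul (1 / 2 : ℂ)
    have e : (1 / 2 : ℂ) * (φ b - φ a + (φ b - φ a) + Complex.I * (φ b - φ a - (φ b - φ a)))
        = φ b - φ a := by ring
    rw [e] at this
    refine this.congr fun h => ?_
    have i1 : IntervalIntegrable (fun x => (φ (x + h) - φ x) / (h : ℂ))
        MeasureTheory.volume a b := by
      refine Continuous.intervalIntegrable ?_ _ _
      exact ((hφ.comp (continuous_add_const h)).sub hφ).div_const _
    have i2 : IntervalIntegrable (fun x => (φ x - φ (x - h)) / (h : ℂ))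
        MeasureTheory.volume a b := by
      refine Continuous.intervalIntegrable ?_ _ _
      exact (hφ.sub (hφ.comp (continuous_sub_right h))).div_const _
    have e2 : ∀ x, (φ (x + -h) - φ x) / ((-h : ℝ) : ℂ) = (φ x - φ (x - h)) / (h : ℂ) := by
      intro x
      rw [Complex.ofReal_neg, div_neg, ← neg_div, neg_sub, sub_eq_add_neg x h]
    rw [intervalIntegral.integral_const_mul, intervalIntegral.integral_add (i1.add i2)
      ((i1.sub i2).const_mul _), intervalIntegral.integral_const_mul,
      intervalIntegral.integral_add i1 i2, intervalIntegral.integral_sub i1 i2]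
    simp only [Function.comp_apply, e2]
  rw [← Set.uIcc_of_le hab] at hD
  refine tendsto_nhds_unique
    (TendstoUniformlyOn.tendsto_intervalIntegral_of_continuousOn ?_ hD) hl
  refine Eventually.of_forall fun h => Continuous.continuousOn ?_
  have c1 := hφ.comp (continuous_add_const h)
  have c2 := hφ.comp (continuous_sub_right h)
  simp only [Function.comp_def] at c1 c2
  fun_prop

/-- The quantum Green theorem: if `f, g : ℝ² → ℝ` are continuous and the
partial quantum derivatives `D₁g`, `D₂f` exist uniformly on
`R = [a,b] × [c,d]`, then
`∫∫_R (D₁g − D₂f) = ∫_a^b (f(x₁,c) − f(x₁,d)) dx₁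
  + ∫_c^d (g(b,x₂) − g(a,x₂)) dx₂`. -/
theorem quantum_green_theorem
    (f g : ℝ × ℝ → ℝ) (hf : Continuous f) (hg : Continuous g)
    (a b c d : ℝ) (hab : a < b) (hcd : c < d)
    (D1g D2f : ℝ × ℝ → ℂ)
    (hD1g : TendstoUniformlyOn (fun h p => boxh1 (fun q => (g q : ℂ)) h p) D1g
      (nhdsWithin 0 (Set.Ioi 0)) (Set.Icc a b ×ˢ Set.Icc c d))
    (hD2f : TendstoUniformlyOn (fun h p => boxh2 (fun q => (f q : ℂ)) h p) D2f
      (nhdsWithin 0 (Set.Ioi 0)) (Set.Icc a b ×ˢ Set.Icc c d)) :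
    (∫ x₂ in c..d, ∫ x₁ in a..b, (D1g (x₁, x₂) - D2f (x₁, x₂)))
      = (∫ x₁ in a..b, ((f (x₁, c) - f (x₁, d) : ℝ) : ℂ))
        + ∫ x₂ in c..d, ((g (b, x₂) - g (a, x₂) : ℝ) : ℂ) := by
  have cg : Continuous (fun q => (g q : ℂ)) := Complex.continuous_ofReal.comp hg
  have cf : Continuous (fun q => (f q : ℂ)) := Complex.continuous_ofReal.comp hf
  have hc1 : ContinuousOn D1g (Set.Icc a b ×ˢ Set.Icc c d) := by
    refine hD1g.continuousOn (Frequently.of_forall fun h => Continuous.continuousOn ?_)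
    unfold boxh1
    fun_prop
  have hc2 : ContinuousOn D2f (Set.Icc a b ×ˢ Set.Icc c d) := by
    refine hD2f.continuousOn (Frequently.of_forall fun h => Continuous.continuousOn ?_)
    unfold boxh2
    fun_prop
  have l1 : ∀ y ∈ Set.Icc c d, ∫ x in a..b, D1g (x, y) = (g (b, y) : ℂ) - g (a, y) := by
    intro y hy
    refine qg_line (fun x => (g (x, y) : ℂ)) (by fun_prop) a b hab.le (fun x => D1g (x, y)) ?_
    exact (hD1g.comp (fun x => (x, y))).mono (fun x hx => ⟨hx, hy⟩)
  have l2 : ∀ x ∈ Set.Icc a b, ∫ y in c..d, D2f (x, y) = (f (x, d) : ℂ) - f (x, c) := by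
    intro x hx
    refine qg_line (fun y => (f (x, y) : ℂ)) (by fun_prop) c d hcd.le (fun y => D2f (x, y)) ?_
    exact (hD2f.comp (fun y => (x, y))).mono (fun y hy => ⟨hx, hy⟩)
  have s1 : ∀ y ∈ Set.Icc c d,
      IntervalIntegrable (fun x => D1g (x, y)) MeasureTheory.volume a b := by
    intro y hy
    refine ContinuousOn.intervalIntegrable ?_
    rw [Set.uIcc_of_le hab.le]
    exact hc1.comp (by fun_prop) (fun x hx => ⟨hx, hy⟩)
  have s2 : ∀ y ∈ Set.Icc c d,
      IntervalIntegrable (fun x => D2f (x, y)) MeasureTheory.volume a b := by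
    intro y hy
    refine ContinuousOn.intervalIntegrable ?_
    rw [Set.uIcc_of_le hab.le]
    exact hc2.comp (by fun_prop) (fun x hx => ⟨hx, hy⟩)
  have hI : MeasureTheory.IntegrableOn D2f (Set.uIoc a b ×ˢ Set.uIoc c d) := by
    refine (hc2.integrableOn_compact (isCompact_Icc.prod isCompact_Icc)).mono_set ?_
    rw [Set.uIoc_of_le hab.le, Set.uIoc_of_le hcd.le]
    exact Set.prod_mono Set.Ioc_subset_Icc_self Set.Ioc_subset_Icc_self
  have hO : IntervalIntegrable (fun y => ∫ x in a..b, D2f (x, y)) MeasureTheory.volume c d := by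
    rw [intervalIntegrable_iff]
    have h := hI
    rw [MeasureTheory.IntegrableOn, MeasureTheory.Measure.volume_eq_prod,
      ← MeasureTheory.Measure.prod_restrict] at h
    have := h.integral_prod_right
    simp only [Set.uIoc_of_le hab.le] at this
    simp only [intervalIntegral.integral_of_le hab.le]
    exact this
  have step : ∫ y in c..d, ∫ x in a..b, (D1g (x, y) - D2f (x, y))
      = ∫ y in c..d, (((g (b, y) : ℂ) - g (a, y)) - ∫ x in a..b, D2f (x, y)) := by
    refine intervalIntegral.integral_congr fun y hy => ?_
    rw [Set.uIcc_of_le hcd.le] at hy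
    rw [intervalIntegral.integral_sub (s1 y hy) (s2 y hy), l1 y hy]
  have swap : ∫ y in c..d, ∫ x in a..b, D2f (x, y)
      = ∫ x in a..b, ((f (x, d) : ℂ) - f (x, c)) := by
    rw [← MeasureTheory.intervalIntegral_intervalIntegral_swap (F := fun x y => D2f (x, y)) hI]
    refine intervalIntegral.integral_congr fun x hx => ?_
    rw [Set.uIcc_of_le hab.le] at hx
    exact l2 x hx
  rw [step, intervalIntegral.integral_sub
    (Continuous.intervalIntegrable (by fun_prop) _ _) hO, swap, sub_eq_neg_add,
    ← intervalIntegral.integral_neg]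
  simp only [neg_sub, Complex.ofReal_sub]
end
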